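/- Let m ≥ 1 be an integer, and for each i ∈ {1,…,m} let α_i ∈ (1,2), w_i > 0, and n_i ≥ 1. Let A = Σ_{i=1}^m I_{n_1}⊗⋯⊗I_{n_{i−1}}⊗(w_i·G_{n_i}^{(α_i)})⊗I_{n_{i+1}}⊗⋯⊗I_{n_m} and P = Σ_{i=1}^m I_{n_1}⊗⋯⊗I_{n_{i−1}}⊗(w_i·τ(G_{n_i}^{(α_i)}))⊗I_{n_{i+1}}⊗⋯⊗I_{n_m} be the corresponding multilevel matrices of size N = n_1⋯n_m. Then for every nonzero z ∈ ℝ^N one has (1/2)·zᵀPz < zᵀAz < (3/2)·zᵀPz; in particular, the spectrum of P^{−1}A is uniformly bounded below by 1/2 and above by 3/2. -/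

import Mathlib

open Matrix

/-- Grünwald–Letnikov coefficients: `g 0 = 1`, `g k = (1 - (α+1)/k) * g (k-1)` for `k ≥ 1`. -/
noncomputable def glCoef (α : ℝ) : ℕ → ℝ
  | 0 => 1
  | k + 1 => (1 - (α + 1) / ((k : ℝ) + 1)) * glCoef α k

/-- First-column entries of `G_n^{(α)}`: `t_0 = -2g_1`, `t_1 = -(g_0+g_2)`, `t_k = -g_{k+1}` for `k ≥ 2`. -/
noncomputable def tC (α : ℝ) : ℕ → ℝ
  | 0 => -2 * glCoef α 1
  | 1 => -(glCoef α 0 + glCoef α 2)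
  | k + 2 => -glCoef α (k + 3)

/-- Padded coefficients: `t_k` for `k < n`, `0` for `k ≥ n`. -/
noncomputable def tpad (n : ℕ) (t : ℕ → ℝ) (k : ℕ) : ℝ := if k < n then t k else 0

/-- The `n×n` symmetric Toeplitz matrix with `(i,j)` entry `t_{|i-j|}`. -/
noncomputable def toeplitzM (n : ℕ) (t : ℕ → ℝ) : Matrix (Fin n) (Fin n) ℝ :=
  fun i j => t (Nat.dist i.val j.val)

/-- The Hankel matrix `(H_n)_{ij} = t_{i+j} + t_{2(n+1)-(i+j)}` (1-based indices,
with the convention `t_k = 0` for `k ≥ n`). Here `i j : Fin n` are 0-based. -/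
noncomputable def hankelM (n : ℕ) (t : ℕ → ℝ) : Matrix (Fin n) (Fin n) ℝ :=
  fun i j => tpad n t (i.val + j.val + 2) + tpad n t (2 * n - (i.val + j.val))

/-- The τ-matrix `τ(T_n) = T_n - H_n`. -/
noncomputable def tauM (n : ℕ) (t : ℕ → ℝ) : Matrix (Fin n) (Fin n) ℝ :=
  toeplitzM n t - hankelM n t

/-- The matrix `G_n^{(α)}`. -/
noncomputable def Gmat (α : ℝ) (n : ℕ) : Matrix (Fin n) (Fin n) ℝ := toeplitzM n (tC α)

/-- The multilevel matrix `Σ_i I_{n_1}⊗⋯⊗M_i⊗⋯⊗I_{n_m}`, indexed by tuples `x y` with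
`(x,y)` entry `Σ_i (M_i)_{x_i y_i} · Π_{j ≠ i} [x_j = y_j]`. -/
noncomputable def multilevel {m : ℕ} (n : Fin m → ℕ)
    (M : (i : Fin m) → Matrix (Fin (n i)) (Fin (n i)) ℝ) :
    Matrix ((i : Fin m) → Fin (n i)) ((i : Fin m) → Fin (n i)) ℝ :=
  fun x y => ∑ i, M i (x i) (y i) * ∏ j ∈ Finset.univ.erase i, (if x j = y j then (1 : ℝ) else 0)

theorem glCoef_succ (α : ℝ) (k : ℕ) :
    glCoef α (k + 1) = (1 - (α + 1) / ((k : ℝ) + 1)) * glCoef α k := rfl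

theorem glCoef_one (α : ℝ) : glCoef α 1 = -α := by
  simp [glCoef]

theorem glCoef_two_pos {α : ℝ} (hα : α ∈ Set.Ioo (1 : ℝ) 2) : 0 < glCoef α 2 := by
  obtain ⟨h1, h2⟩ := hα
  rw [glCoef_succ, glCoef_one]
  push_cast
  nlinarith

theorem glCoef_pos {α : ℝ} (hα : α ∈ Set.Ioo (1 : ℝ) 2) (k : ℕ) : 0 < glCoef α (k + 2) := by
  induction k with
  | zero => exact glCoef_two_pos hα
  | succ k ih =>
    rw [glCoef_succ]
    refine mul_pos ?_ ih
    rw [sub_pos, div_lt_one (by positivity)]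
    push_cast
    have := hα.2
    have : (0 : ℝ) ≤ k := k.cast_nonneg
    linarith

theorem glCoef_succ_le {α : ℝ} (hα : α ∈ Set.Ioo (1 : ℝ) 2) (k : ℕ) :
    glCoef α (k + 3) ≤ glCoef α (k + 2) := by
  rw [glCoef_succ]
  refine mul_le_of_le_one_left (glCoef_pos hα k).le ?_
  have := hα.1
  have : 0 ≤ (α + 1) / (((k + 2 : ℕ) : ℝ) + 1) := by positivity
  linarith

theorem mul_sum_glCoef (α : ℝ) (n : ℕ) :
    α * ∑ k ∈ Finset.range (n + 1), glCoef α k = -((n : ℝ) + 1) * glCoef α (n + 1) := by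
  induction n with
  | zero => simp [glCoef]
  | succ n ih =>
    rw [Finset.sum_range_succ, mul_add, ih, glCoef_succ α (n + 1)]
    push_cast
    field_simp
    ring

theorem sum_glCoef_neg {α : ℝ} (hα : α ∈ Set.Ioo (1 : ℝ) 2) (n : ℕ) :
    ∑ k ∈ Finset.range (n + 2), glCoef α k < 0 := by
  have h := mul_sum_glCoef α (n + 1)
  have hg := glCoef_pos hα n
  have hα0 : 0 < α := by linarith [hα.1]
  have : α * ∑ k ∈ Finset.range (n + 2), glCoef α k < 0 := by
    rw [h]
    have : 0 < ((n + 1 : ℕ) : ℝ) + 1 := by positivity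
    have := mul_pos this hg
    linarith
  exact neg_of_mul_neg_right this hα0.le

theorem tC_zero (α : ℝ) : tC α 0 = 2 * α := by
  simp [tC, glCoef_one]

theorem tC_succ_neg {α : ℝ} (hα : α ∈ Set.Ioo (1 : ℝ) 2) (k : ℕ) : tC α (k + 1) < 0 := by
  cases k with
  | zero =>
    have := glCoef_two_pos hα
    simp only [tC, glCoef]
    simp only [glCoef] at this
    linarith
  | succ k =>
    have := glCoef_pos hα (k + 1)
    simpa [tC] using this

theorem tC_succ_monotone {α : ℝ} (hα : α ∈ Set.Ioo (1 : ℝ) 2) :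
    Monotone fun k => tC α (k + 1) := by
  refine monotone_nat_of_le_succ fun k => ?_
  cases k with
  | zero =>
    have := glCoef_succ_le hα 0
    have h0 : glCoef α 0 = 1 := rfl
    simp only [tC, h0]
    simp only [zero_add] at this
    linarith
  | succ k =>
    simpa [tC] using glCoef_succ_le hα (k + 1)

theorem sum_neg_tC (α : ℝ) (n : ℕ) :
    ∑ k ∈ Finset.range (n + 1), -tC α (k + 1) =
      α + ∑ k ∈ Finset.range (n + 3), glCoef α k := by
  induction n with
  | zero =>
    simp only [Finset.sum_range_succ, Finset.sum_range_zero, tC, glCoef_one]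
    ring
  | succ n ih =>
    rw [Finset.sum_range_succ, ih, Finset.sum_range_succ _ (n + 3)]
    simp only [tC]
    ring

theorem sum_neg_tC_lt {α : ℝ} (hα : α ∈ Set.Ioo (1 : ℝ) 2) (n : ℕ) :
    ∑ k ∈ Finset.range n, -tC α (k + 1) < α := by
  cases n with
  | zero => simpa using by linarith [hα.1]
  | succ n =>
    rw [sum_neg_tC]
    linarith [sum_glCoef_neg hα (n + 1)]

/-- Folding at one end: the values `b (i - j)` and `b (i + j + 2)` for `j < n` are distinct
terms of the sequence `b`. -/
theorem sum_sub_add_sum_le {n i : ℕ} (hi : i < n) {b : ℕ → ℝ} (hb : ∀ k, 0 ≤ b k)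
    (h0 : b 0 = 0) (hn : ∀ k, n ≤ k → b k = 0) :
    ∑ j ∈ Finset.range n, (b (i - j) + b (i + j + 2)) ≤ ∑ k ∈ Finset.range n, b k := by
  have e1 : ∑ j ∈ Finset.range n, b (i - j) = ∑ k ∈ Finset.range (i + 1), b k := by
    rw [← Finset.sum_range_reflect b (i + 1)]
    symm
    refine Finset.sum_subset_zero_on_sdiff (by simpa using hi) ?_ ?_
    · intro j hj
      simp only [Finset.mem_sdiff, Finset.mem_range] at hj
      rw [Nat.sub_eq_zero_of_le (by omega), h0]
    · intro j _
      simp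
  have e2 : ∑ j ∈ Finset.range n, b (i + j + 2) ≤
      ∑ j ∈ Finset.range (n + 1), b (i + 1 + j) := by
    rw [Finset.sum_range_succ' _ n]
    have : ∀ j, i + 1 + (j + 1) = i + j + 2 := fun j => by omega
    simp only [this]
    linarith [hb (i + 1 + 0)]
  have e3 : ∑ k ∈ Finset.range (i + 1 + (n + 1)), b k = ∑ k ∈ Finset.range n, b k := by
    symm
    refine Finset.sum_subset (Finset.range_mono (by omega)) ?_
    intro j _ hj
    exact hn j (by simpa using hj)
  have e4 := Finset.sum_range_add b (i + 1) (n + 1)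
  rw [Finset.sum_add_distrib, e1, ← e3, e4]
  linarith

theorem sum_dist_add_hankel_le {n i : ℕ} (hi : i < n) {b : ℕ → ℝ} (hb : ∀ k, 0 ≤ b k)
    (h0 : b 0 = 0) (hn : ∀ k, n ≤ k → b k = 0) :
    ∑ j ∈ Finset.range n, (b (Nat.dist i j) + (b (i + j + 2) + b (2 * n - (i + j)))) ≤
      2 * ∑ k ∈ Finset.range n, b k := by
  have h1 := sum_sub_add_sum_le hi hb h0 hn
  have h2 := sum_sub_add_sum_le (i := n - 1 - i) (by omega) hb h0 hn
  rw [← Finset.sum_range_reflect] at h2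
  rw [two_mul (∑ k ∈ Finset.range n, b k)]
  refine le_trans (le_of_eq ?_) (add_le_add h1 h2)
  rw [← Finset.sum_add_distrib]
  refine Finset.sum_congr rfl fun j hj => ?_
  have hj := Finset.mem_range.1 hj
  have a1 : n - 1 - i - (n - 1 - j) = j - i := by omega
  have a2 : n - 1 - i + (n - 1 - j) + 2 = 2 * n - (i + j) := by omega
  rw [a1, a2]
  have : b (Nat.dist i j) = b (i - j) + b (j - i) := by
    unfold Nat.dist
    rcases le_total i j with h | h
    · simp [Nat.sub_eq_zero_of_le h, h0]
    · simp [Nat.sub_eq_zero_of_le h, h0]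
  rw [this]
  ring

theorem hankelM_nonpos {α : ℝ} (hα : α ∈ Set.Ioo (1 : ℝ) 2) {n : ℕ} (i j : Fin n) :
    hankelM n (tC α) i j ≤ 0 := by
  have key : ∀ k, 0 < k → tpad n (tC α) k ≤ 0 := by
    intro k hk
    obtain ⟨k, rfl⟩ := Nat.exists_eq_succ_of_ne_zero hk.ne'
    unfold tpad
    split_ifs
    · exact (tC_succ_neg hα k).le
    · exact le_rfl
  exact add_nonpos (key _ (by omega)) (key _ (by omega))

/-- At most one of the two Hankel contributions is nonzero, and it is dominated by the
corresponding off-diagonal Toeplitz entry. -/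
theorem toeplitzM_le_hankelM {α : ℝ} (hα : α ∈ Set.Ioo (1 : ℝ) 2) {n : ℕ} {i j : Fin n}
    (hij : i ≠ j) : toeplitzM n (tC α) i j ≤ hankelM n (tC α) i j := by
  have hne : i.val ≠ j.val := fun h => hij (Fin.ext h)
  have hd : 0 < Nat.dist i.val j.val := Nat.dist_pos_of_ne hne
  have hdef : Nat.dist i.val j.val = i.val - j.val + (j.val - i.val) := rfl
  have key : ∀ k, Nat.dist i.val j.val ≤ k → tC α (Nat.dist i.val j.val) ≤ tC α k := by
    intro k hk
    have := tC_succ_monotone hα (Nat.sub_le_sub_right hk 1)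
    simpa [Nat.sub_add_cancel (show 1 ≤ k by omega),
      Nat.sub_add_cancel (show 1 ≤ Nat.dist i.val j.val from hd)] using this
  have hneg : tC α (Nat.dist i.val j.val) ≤ 0 := by
    have := tC_succ_neg hα (Nat.dist i.val j.val - 1)
    rw [Nat.sub_add_cancel hd] at this
    exact this.le
  simp only [toeplitzM, hankelM, tpad]
  split_ifs with h1 h2 h2
  · omega
  · simpa using key _ (by omega)
  · simpa using key _ (by omega)
  · simpa using hneg

theorem toeplitz_hankel_row_lt {α : ℝ} (hα : α ∈ Set.Ioo (1 : ℝ) 2) {n : ℕ} (i : Fin n) :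
    ∑ j ∈ Finset.univ.erase i, -(toeplitzM n (tC α) i j + hankelM n (tC α) i j) <
      toeplitzM n (tC α) i i + hankelM n (tC α) i i := by
  set b : ℕ → ℝ := fun k => if k = 0 then 0 else -tpad n (tC α) k
  have hb : ∀ k, 0 ≤ b k := by
    intro k
    cases k with
    | zero => simp [b]
    | succ k =>
      simp only [b, tpad]
      split_ifs <;> simp_all [(tC_succ_neg hα k).le]
  have h0 : b 0 = 0 := by simp [b]
  have hn : ∀ k, n ≤ k → b k = 0 := by
    intro k hk
    simp [b, tpad, not_lt.2 hk]
  have hrow := sum_dist_add_hankel_le i.isLt hb h0 hn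
  rw [← Fin.sum_univ_eq_sum_range
    (fun j => b (Nat.dist i j) + (b (i + j + 2) + b (2 * n - (i + j))))] at hrow
  have hsum : ∑ k ∈ Finset.range n, b k < α := by
    obtain ⟨n', rfl⟩ : ∃ n', n = n' + 1 := ⟨n - 1, by have := i.isLt; omega⟩
    rw [Finset.sum_range_succ', h0, add_zero]
    refine lt_of_eq_of_lt (Finset.sum_congr rfl fun k hk => ?_) (sum_neg_tC_lt hα n')
    have := Finset.mem_range.1 hk
    simp [b, tpad, this]
  have hH : ∀ j : Fin n, b (i + j + 2) + b (2 * n - (i + j)) = -hankelM n (tC α) i j := by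
    intro j
    have : 2 * n - (i.val + j.val) ≠ 0 := by omega
    simp only [b, this, hankelM, if_false]
    simp
    ring
  have hT : ∀ j : Fin n, j ≠ i → b (Nat.dist i j) = -toeplitzM n (tC α) i j := by
    intro j hj
    have hne : i.val ≠ j.val := fun h => hj (Fin.ext h.symm)
    have h1 : Nat.dist i.val j.val ≠ 0 := (Nat.dist_pos_of_ne hne).ne'
    have h2 : Nat.dist i.val j.val < n := by
      have : Nat.dist i.val j.val = i.val - j.val + (j.val - i.val) := rfl
      omega
    simp [b, h1, h2, tpad, toeplitzM]
  rw [← Finset.add_sum_erase _ _ (Finset.mem_univ i), hH, Nat.dist_self, h0] at hrow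
  have hcongr : ∑ j ∈ Finset.univ.erase i, -(toeplitzM n (tC α) i j + hankelM n (tC α) i j) =
      ∑ j ∈ Finset.univ.erase i,
        (b (Nat.dist i j) + (b (i + j + 2) + b (2 * n - (i + j)))) := by
    refine Finset.sum_congr rfl fun j hj => ?_
    rw [hT j (Finset.ne_of_mem_erase hj), hH]
    ring
  have hdiag : toeplitzM n (tC α) i i = 2 * α := by
    simp [toeplitzM, tC_zero]
  rw [hcongr, hdiag]
  linarith

/-- A symmetric, strictly diagonally dominant real matrix with positive diagonal has a positive
quadratic form. -/
theorem dotProduct_mulVec_pos_of_diag_dominant {ι : Type*} [Fintype ι] [DecidableEq ι]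
    {B : Matrix ι ι ℝ} (hs : ∀ i j, B i j = B j i)
    (hd : ∀ i, ∑ j ∈ Finset.univ.erase i, |B i j| < B i i) {v : ι → ℝ} (hv : v ≠ 0) :
    0 < v ⬝ᵥ B.mulVec v := by
  set c : ι → ι → ℝ := fun i j => if j = i then 0 else |B i j|
  have hcs : ∀ i j, c i j = c j i := by
    intro i j
    simp only [c, hs i j, eq_comm]
  have hcd : ∀ i, ∑ j, c i j < B i i := by
    intro i
    refine lt_of_eq_of_lt ?_ (hd i)
    rw [← Finset.add_sum_erase _ _ (Finset.mem_univ i)]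
    simp only [c, if_true, zero_add]
    exact Finset.sum_congr rfl fun j hj => if_neg (Finset.ne_of_mem_erase hj)
  have hswap : ∑ i, ∑ j, c i j * v j ^ 2 = ∑ i, ∑ j, c i j * v i ^ 2 := by
    rw [Finset.sum_comm]
    exact Finset.sum_congr rfl fun i _ => Finset.sum_congr rfl fun j _ => by rw [hcs]
  have hlow : ∑ i, (B i i * v i ^ 2 - ∑ j, c i j * (v i ^ 2 + v j ^ 2) / 2) ≤
      v ⬝ᵥ B.mulVec v := by
    simp only [dotProduct, mulVec, Finset.mul_sum]
    refine Finset.sum_le_sum fun i _ => ?_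
    rw [← Finset.add_sum_erase _ _ (Finset.mem_univ i),
      ← Finset.add_sum_erase _ (fun j => v i * (B i j * v j)) (Finset.mem_univ i)]
    have : ∑ j ∈ Finset.univ.erase i, -(c i j * (v i ^ 2 + v j ^ 2) / 2) ≤
        ∑ j ∈ Finset.univ.erase i, v i * (B i j * v j) := by
      refine Finset.sum_le_sum fun j hj => ?_
      have hcij : c i j = |B i j| := if_neg (Finset.ne_of_mem_erase hj)
      rw [hcij]
      rcases abs_cases (B i j) with ⟨h, h'⟩ | ⟨h, h'⟩ <;> rw [h]
      · nlinarith [mul_nonneg h' (sq_nonneg (v i + v j))]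
      · nlinarith [mul_nonneg (neg_nonneg.2 h'.le) (sq_nonneg (v i - v j))]
    rw [Finset.sum_neg_distrib] at this
    have hcii : c i i = 0 := if_pos rfl
    rw [hcii]
    linarith
  refine lt_of_lt_of_le ?_ hlow
  have heq : ∑ i, (B i i * v i ^ 2 - ∑ j, c i j * (v i ^ 2 + v j ^ 2) / 2) =
      ∑ i, (B i i - ∑ j, c i j) * v i ^ 2 := by
    simp only [sub_mul, Finset.sum_sub_distrib, Finset.sum_mul]
    congr 1
    have : ∑ i, ∑ j, c i j * (v i ^ 2 + v j ^ 2) / 2 =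
        (∑ i, ∑ j, c i j * v i ^ 2 + ∑ i, ∑ j, c i j * v j ^ 2) / 2 := by
      simp only [mul_add, add_div, Finset.sum_add_distrib, Finset.sum_div]
    rw [this, hswap]
    ring
  rw [heq]
  obtain ⟨i, hi⟩ := Function.ne_iff.1 hv
  refine Finset.sum_pos' (fun i _ => mul_nonneg (sub_nonneg.2 (hcd i).le) (sq_nonneg _))
    ⟨i, Finset.mem_univ i, mul_pos (sub_pos.2 (hcd i)) ?_⟩
  exact sq_pos_of_ne_zero hi

theorem toeplitzM_symm (n : ℕ) (t : ℕ → ℝ) (i j : Fin n) :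
    toeplitzM n t i j = toeplitzM n t j i := by
  simp [toeplitzM, Nat.dist_comm]

theorem hankelM_symm (n : ℕ) (t : ℕ → ℝ) (i j : Fin n) :
    hankelM n t i j = hankelM n t j i := by
  simp [hankelM, add_comm]

theorem toeplitzM_add_hankelM_pos {α : ℝ} (hα : α ∈ Set.Ioo (1 : ℝ) 2) {n : ℕ}
    {v : Fin n → ℝ} (hv : v ≠ 0) :
    0 < v ⬝ᵥ (toeplitzM n (tC α) + hankelM n (tC α)).mulVec v := by
  refine dotProduct_mulVec_pos_of_diag_dominant (fun i j => ?_) (fun i => ?_) hv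
  · simp [toeplitzM_symm n _ i j, hankelM_symm n _ i j]
  · refine lt_of_eq_of_lt (Finset.sum_congr rfl fun j hj => ?_) (toeplitz_hankel_row_lt hα i)
    have h1 := toeplitzM_le_hankelM hα (Finset.ne_of_mem_erase hj).symm
    have h2 := hankelM_nonpos hα i j
    rw [Matrix.add_apply, abs_of_nonpos (by linarith)]

theorem toeplitzM_sub_hankelM_pos {α : ℝ} (hα : α ∈ Set.Ioo (1 : ℝ) 2) {n : ℕ}
    {v : Fin n → ℝ} (hv : v ≠ 0) :
    0 < v ⬝ᵥ (toeplitzM n (tC α) - (3 : ℝ) • hankelM n (tC α)).mulVec v := by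
  refine dotProduct_mulVec_pos_of_diag_dominant (fun i j => ?_) (fun i => ?_) hv
  · simp [toeplitzM_symm n _ i j, hankelM_symm n _ i j]
  · refine lt_of_le_of_lt (Finset.sum_le_sum fun j hj => ?_)
      ((toeplitz_hankel_row_lt hα i).trans_le ?_)
    · have h1 := toeplitzM_le_hankelM hα (Finset.ne_of_mem_erase hj).symm
      have h2 := hankelM_nonpos hα i j
      simp only [Matrix.sub_apply, Matrix.smul_apply, smul_eq_mul]
      rw [abs_le]
      constructor <;> linarith
    · have h2 := hankelM_nonpos hα i i
      simp only [Matrix.sub_apply, Matrix.smul_apply, smul_eq_mul]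
      linarith

theorem multilevel_add {m : ℕ} (n : Fin m → ℕ)
    (M N : (i : Fin m) → Matrix (Fin (n i)) (Fin (n i)) ℝ) :
    multilevel n (fun i => M i + N i) = multilevel n M + multilevel n N := by
  ext x y
  simp [multilevel, add_mul, Finset.sum_add_distrib]

theorem multilevel_smul {m : ℕ} (n : Fin m → ℕ) (c : ℝ)
    (M : (i : Fin m) → Matrix (Fin (n i)) (Fin (n i)) ℝ) :
    multilevel n (fun i => c • M i) = c • multilevel n M := by
  ext x y
  simp [multilevel, Finset.mul_sum, mul_assoc]

/-- The quadratic form of one level splits as a sum over the fibres of the remaining indices. -/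
theorem sum_level_eq {ι : Type*} [Fintype ι] [DecidableEq ι] {β : ι → Type*}
    [∀ i, Fintype (β i)] [∀ i, DecidableEq (β i)] (i : ι) (B : Matrix (β i) (β i) ℝ)
    (z : ((i : ι) → β i) → ℝ) :
    ∑ x, ∑ y, z x * ((B (x i) (y i) *
        ∏ j ∈ Finset.univ.erase i, (if x j = y j then (1 : ℝ) else 0)) * z y) =
      ∑ r, (fun a => z ((Equiv.piSplitAt i β).symm (a, r))) ⬝ᵥ
        B.mulVec (fun a => z ((Equiv.piSplitAt i β).symm (a, r))) := by
  set e := (Equiv.piSplitAt i β).symm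
  have hprod : ∀ p q : β i × ((j : { j // j ≠ i }) → β j),
      ∏ j ∈ Finset.univ.erase i, (if e p j = e q j then (1 : ℝ) else 0) =
        if p.2 = q.2 then 1 else 0 := by
    intro p q
    rw [Finset.prod_ite_zero]
    simp only [Finset.prod_const_one]
    refine if_congr ⟨fun h => funext fun j => ?_, fun h j hj => ?_⟩ rfl rfl
    · have := h j.1 (by simp [j.2])
      simpa [e, Equiv.piSplitAt, j.2] using this
    · have := congrFun h ⟨j, Finset.ne_of_mem_erase hj⟩
      simpa [e, Equiv.piSplitAt, Finset.ne_of_mem_erase hj] using this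
  have hi : ∀ p, e p i = p.1 := by
    intro p
    simp [e, Equiv.piSplitAt]
  rw [← e.sum_comp]
  simp only [← e.sum_comp (fun y => z _ * ((B _ (y i) * _) * z y)), hprod, hi]
  rw [Fintype.sum_prod_type_right]
  refine Finset.sum_congr rfl fun r _ => ?_
  simp only [dotProduct, mulVec, Finset.mul_sum]
  refine Finset.sum_congr rfl fun a _ => ?_
  rw [Fintype.sum_prod_type]
  refine Finset.sum_congr rfl fun b _ => ?_
  simp

theorem multilevel_pos {m : ℕ} (hm : 1 ≤ m) (n : Fin m → ℕ)
    {M : (i : Fin m) → Matrix (Fin (n i)) (Fin (n i)) ℝ}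
    (hM : ∀ i, ∀ v : Fin (n i) → ℝ, v ≠ 0 → 0 < v ⬝ᵥ (M i).mulVec v)
    {z : ((i : Fin m) → Fin (n i)) → ℝ} (hz : z ≠ 0) :
    0 < z ⬝ᵥ (multilevel n M).mulVec z := by
  have hsplit : z ⬝ᵥ (multilevel n M).mulVec z =
      ∑ i, ∑ x, ∑ y, z x * ((M i (x i) (y i) *
        ∏ j ∈ Finset.univ.erase i, (if x j = y j then (1 : ℝ) else 0)) * z y) := by
    simp only [dotProduct, mulVec, multilevel, Finset.mul_sum, Finset.sum_mul]
    rw [Finset.sum_comm' (t' := Finset.univ) (s' := fun _ => Finset.univ) (by simp)]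
    rw [Finset.sum_comm]
    conv_rhs => rw [Finset.sum_comm]
    refine Finset.sum_congr rfl fun x _ => ?_
    rw [Finset.sum_comm]
  rw [hsplit]
  have : Nonempty (Fin m) := ⟨⟨0, hm⟩⟩
  refine Finset.sum_pos (fun i _ => ?_) Finset.univ_nonempty
  rw [sum_level_eq i (M i) z]
  obtain ⟨x, hx⟩ := Function.ne_iff.1 hz
  refine Finset.sum_pos' (fun r _ => ?_)
    ⟨((Equiv.piSplitAt i _) x).2, Finset.mem_univ _, hM i _ fun h => hx ?_⟩
  · by_cases hv : (fun a => z ((Equiv.piSplitAt i _).symm (a, r))) = 0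
    · simp [hv]
    · exact (hM i _ hv).le
  · have := congrFun h (x i)
    have hxe : (Equiv.piSplitAt i (fun i => Fin (n i))).symm
        (x i, ((Equiv.piSplitAt i (fun i => Fin (n i))) x).2) = x :=
      (Equiv.piSplitAt i (fun i => Fin (n i))).symm_apply_apply x
    rwa [hxe] at this

theorem multilevel_rayleigh_bounds (m : ℕ) (hm : 1 ≤ m) (n : Fin m → ℕ) (hn : ∀ i, 1 ≤ n i)
    (α w : Fin m → ℝ) (hα : ∀ i, α i ∈ Set.Ioo (1 : ℝ) 2) (hw : ∀ i, 0 < w i)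
    (z : ((i : Fin m) → Fin (n i)) → ℝ) (hz : z ≠ 0) :
    (1 / 2) * (z ⬝ᵥ (multilevel n (fun i => w i • tauM (n i) (tC (α i)))).mulVec z) <
      z ⬝ᵥ (multilevel n (fun i => w i • Gmat (α i) (n i))).mulVec z ∧
    z ⬝ᵥ (multilevel n (fun i => w i • Gmat (α i) (n i))).mulVec z <
      (3 / 2) * (z ⬝ᵥ (multilevel n (fun i => w i • tauM (n i) (tC (α i)))).mulVec z) := by
  set P := multilevel n (fun i => w i • tauM (n i) (tC (α i)))
  set A := multilevel n (fun i => w i • Gmat (α i) (n i))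
  have hlow : A + (-(1 / 2) : ℝ) • P = multilevel n (fun i =>
      (w i / 2) • (toeplitzM (n i) (tC (α i)) + hankelM (n i) (tC (α i)))) := by
    rw [← multilevel_smul, ← multilevel_add]
    congr 1
    ext i a b
    simp [tauM, Gmat]
    ring
  have hupp : (3 / 2 : ℝ) • P + (-1 : ℝ) • A = multilevel n (fun i =>
      (w i / 2) • (toeplitzM (n i) (tC (α i)) - (3 : ℝ) • hankelM (n i) (tC (α i)))) := by
    rw [← multilevel_smul, ← multilevel_smul, ← multilevel_add]
    congr 1
    ext i a b
    simp [tauM, Gmat]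
    ring
  have h1 : 0 < z ⬝ᵥ (A + (-(1 / 2) : ℝ) • P).mulVec z := by
    rw [hlow]
    refine multilevel_pos hm n (fun i v hv => ?_) hz
    rw [smul_mulVec, dotProduct_smul]
    exact mul_pos (half_pos (hw i)) (toeplitzM_add_hankelM_pos (hα i) hv)
  have h2 : 0 < z ⬝ᵥ ((3 / 2 : ℝ) • P + (-1 : ℝ) • A).mulVec z := by
    rw [hupp]
    refine multilevel_pos hm n (fun i v hv => ?_) hz
    rw [smul_mulVec, dotProduct_smul]
    exact mul_pos (half_pos (hw i)) (toeplitzM_sub_hankelM_pos (hα i) hv)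
  simp only [add_mulVec, smul_mulVec, dotProduct_add, dotProduct_smul, smul_eq_mul] at h1 h2
  constructor <;> linarith
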